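/- For all nonnegative integers n and k, Σ_{m=0}^{n} (−1)^m · S(n,m) · ĉ_{m,k} = (−1)^n · (n+1)^k. -/

import Mathlib

/-- Unsigned Stirling numbers of the first kind:
`c(0,0)=1`, `c(n,m)=0` for `m>n` or (`n>0` and `m=0`), and `c(n+1,m)=n*c(n,m)+c(n,m-1)`. -/
def stirling1 : ℕ → ℕ → ℕ
  | 0, 0 => 1
  | 0, _ + 1 => 0
  | _ + 1, 0 => 0
  | n + 1, m + 1 => n * stirling1 n (m + 1) + stirling1 n m

/-- Stirling numbers of the second kind:
`S(0,0)=1`, `S(n,m)=0` for `m>n` or (`n>0` and `m=0`), and `S(n+1,m)=m*S(n,m)+S(n,m-1)`. -/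
def stirling2 : ℕ → ℕ → ℕ
  | 0, 0 => 1
  | 0, _ + 1 => 0
  | _ + 1, 0 => 0
  | n + 1, m + 1 => (m + 1) * stirling2 n (m + 1) + stirling2 n m

/-- Poly-Cauchy numbers of the second kind (negated upper index, unsigned):
`ĉ_{n,k} = Σ_{m=0}^n c(n,m)·(m+1)^k`. -/
def polyCauchy (n k : ℕ) : ℕ := ∑ m ∈ Finset.range (n + 1), stirling1 n m * (m + 1) ^ k

theorem stirling1_eq_zero_of_lt {n m : ℕ} (h : n < m) : stirling1 n m = 0 := by
  induction n generalizing m with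
  | zero => cases m with
    | zero => omega
    | succ m => rfl
  | succ n ih => cases m with
    | zero => omega
    | succ m => simp [stirling1, ih (show n < m + 1 by omega), ih (show n < m by omega)]

theorem stirling2_eq_zero_of_lt {n m : ℕ} (h : n < m) : stirling2 n m = 0 := by
  induction n generalizing m with
  | zero => cases m with
    | zero => omega
    | succ m => rfl
  | succ n ih => cases m with
    | zero => omega
    | succ m => simp [stirling2, ih (show n < m + 1 by omega), ih (show n < m by omega)]

/-- The transform of a sequence by the unsigned Stirling numbers of the first kind. -/
def stirling1Transform (f : ℕ → ℤ) (n : ℕ) : ℤ :=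
  ∑ m ∈ Finset.range (n + 1), (stirling1 n m : ℤ) * f m

theorem stirling1Transform_succ (f : ℕ → ℤ) (n : ℕ) :
    stirling1Transform f (n + 1) =
      n * stirling1Transform f n + stirling1Transform (fun m ↦ f (m + 1)) n := by
  have h₀ : (n : ℤ) * stirling1 n 0 = 0 := by cases n <;> simp [stirling1]
  have shift : (n : ℤ) * ∑ m ∈ Finset.range (n + 1), (stirling1 n (m + 1) : ℤ) * f (m + 1) =
      n * ∑ m ∈ Finset.range (n + 1), (stirling1 n m : ℤ) * f m := by
    have h := (Finset.sum_range_succ' (fun m ↦ (stirling1 n m : ℤ) * f m) (n + 1)).symm.trans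
      (Finset.sum_range_succ _ _)
    rw [stirling1_eq_zero_of_lt (Nat.lt_succ_self n)] at h
    linear_combination (n : ℤ) * h - f 0 * h₀
  unfold stirling1Transform
  rw [Finset.sum_range_succ', ← shift, Finset.mul_sum, ← Finset.sum_add_distrib]
  simp only [stirling1, Nat.cast_zero, zero_mul, add_zero]
  refine Finset.sum_congr rfl fun m _ ↦ ?_
  push_cast
  ring

/-- The signed transform by Stirling numbers of the second kind inverts `stirling1Transform`,
up to sign. -/
theorem sum_stirling2_mul_stirling1Transform (f : ℕ → ℤ) (n : ℕ) :
    ∑ m ∈ Finset.range (n + 1), (-1 : ℤ) ^ m * stirling2 n m * stirling1Transform f m =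
      (-1 : ℤ) ^ n * f n := by
  induction n generalizing f with
  | zero => simp [stirling1Transform, stirling1, stirling2]
  | succ n ih =>
    have h := (Finset.sum_range_succ'
      (fun m ↦ (-1 : ℤ) ^ m * m * stirling2 n m * stirling1Transform f m) (n + 1)).symm.trans
      (Finset.sum_range_succ _ _)
    simp only [stirling2_eq_zero_of_lt (Nat.lt_succ_self n), Nat.cast_zero, mul_zero, zero_mul,
      add_zero] at h
    have key : ∑ m ∈ Finset.range (n + 1),
          (-1 : ℤ) ^ (m + 1) * stirling2 (n + 1) (m + 1) * stirling1Transform f (m + 1) =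
        ∑ m ∈ Finset.range (n + 1), (-1 : ℤ) ^ (m + 1) * ((m + 1 : ℕ) : ℤ) *
          stirling2 n (m + 1) * stirling1Transform f (m + 1) -
        ∑ m ∈ Finset.range (n + 1), (-1 : ℤ) ^ m * m * stirling2 n m * stirling1Transform f m -
        ∑ m ∈ Finset.range (n + 1),
          (-1 : ℤ) ^ m * stirling2 n m * stirling1Transform (fun m ↦ f (m + 1)) m := by
      rw [← Finset.sum_sub_distrib, ← Finset.sum_sub_distrib]
      refine Finset.sum_congr rfl fun m _ ↦ ?_
      simp only [stirling2, stirling1Transform_succ]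
      push_cast
      ring
    rw [Finset.sum_range_succ', key, h, ih]
    simp only [stirling2, Nat.cast_zero, mul_zero, zero_mul]
    ring

theorem alternating_stirling2_polyCauchy (n k : ℕ) :
    ∑ m ∈ Finset.range (n + 1), (-1 : ℤ) ^ m * stirling2 n m * polyCauchy m k
      = (-1 : ℤ) ^ n * (n + 1) ^ k := by
  simpa [stirling1Transform, polyCauchy] using
    sum_stirling2_mul_stirling1Transform (fun m ↦ ((m : ℤ) + 1) ^ k) n
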